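/- Let η ≥ 0, N ≥ 1, and b > 0, and let ψ ∈ C_c^∞(ℝ^N; ℂ) be symmetric and normalized, with one-particle density ρ(x) := N·∫|ψ(x, x_2,…,x_N)|² dx_2⋯dx_N satisfying (∫_Q ρ)/|Q| ≤ b for every finite interval Q. Let V : ℝ → ℝ be measurable with negative part V₋ := (V − |V|)/2 satisfying ∫|V₋|^{3/2} < ∞. Then, with T_S(ψ) := (1/2)·∫_{ℝ^N} ‖∇ψ‖² dx + 2η·∑_{1≤j<k≤N} ∫_{ℝ^{N−1}} |ψ(x)|²|_{x_j = x_k = t} dt ∏_{l≠j,k} dx_l, one has T_S(ψ) + ∫_{ℝ^N} ∑_{j=1}^N V(x_j)·|ψ|² dx ≥ −( (2/3)·(9·10⁻⁵)^{−1/2} / ξ_S(2η/b) ) · ∫_ℝ |V₋(x)|^{3/2} dx, provided ξ_S(2η/b) > 0 (i.e. η > 0). -/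

import Mathlib

open MeasureTheory

/-- The point of `ℝᴺ` whose `j`-th and `k`-th coordinates equal `t` and whose remaining
coordinates are given by `z`. -/
def insertPair {N : ℕ} (j k : Fin N) (t : ℝ)
    (z : {l : Fin N // l ≠ j ∧ l ≠ k} → ℝ) : Fin N → ℝ :=
  fun l => if h : l = j ∨ l = k then t else z ⟨l, not_or.mp h⟩

/-- `∫ |ψ|²` over all particle coordinates except the `j`-th one, which is set to `y`. -/
noncomputable def densityAt {N : ℕ} (ψ : (Fin N → ℝ) → ℂ) (j : Fin N) (y : ℝ) : ℝ :=
  ∫ z : {k : Fin N // k ≠ j} → ℝ,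
    ‖ψ (fun k => if h : k = j then y else z ⟨k, h⟩)‖ ^ 2

section Interval

variable {u u' : ℝ → ℂ} {a c x y : ℝ}

/-- The oscillation of a function over an interval is bounded by the integral of any continuous
majorant of its derivative. -/
lemma norm_sub_le_integral_of_hasDerivAt {E : Type*} [NormedAddCommGroup E] [NormedSpace ℝ E]
    [CompleteSpace E] {f f' : ℝ → E} {g : ℝ → ℝ} (hf : ∀ t, HasDerivAt f (f' t) t)
    (hf' : Continuous f') (hg : Continuous g) (hle : ∀ t, ‖f' t‖ ≤ g t)
    (hx : x ∈ Set.Icc a c) (hy : y ∈ Set.Icc a c) :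
    ‖f x - f y‖ ≤ ∫ t in a..c, g t := by
  have key : ∀ s t : ℝ, a ≤ s → s ≤ t → t ≤ c → ‖f t - f s‖ ≤ ∫ r in a..c, g r := by
    intro s t has hst htc
    rw [← intervalIntegral.integral_eq_sub_of_hasDerivAt (fun r _ => hf r)
      (hf'.intervalIntegrable _ _)]
    calc ‖∫ r in s..t, f' r‖ ≤ ∫ r in s..t, g r :=
          intervalIntegral.norm_integral_le_of_norm_le hst
            (Filter.Eventually.of_forall fun r _ => hle r) (hg.intervalIntegrable _ _)
      _ ≤ ∫ r in a..c, g r :=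
          intervalIntegral.integral_mono_interval has hst htc
            (Filter.Eventually.of_forall fun r => (norm_nonneg _).trans (hle r))
            (hg.intervalIntegrable _ _)
  rcases le_total x y with h | h
  · rw [norm_sub_rev]
    exact key x y hx.1 h hy.2
  · exact key y x hy.1 h hx.2

lemma normSq_le_add_integral (hu : ∀ t, HasDerivAt u (u' t) t) (hu' : Continuous u')
    (hx : x ∈ Set.Icc a c) (hy : y ∈ Set.Icc a c) {α : ℝ} (hα : 0 < α) :
    ‖u x‖ ^ 2 ≤ ‖u y‖ ^ 2 + α * (∫ t in a..c, ‖u t‖ ^ 2) + α⁻¹ * ∫ t in a..c, ‖u' t‖ ^ 2 := by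
  have hcu : Continuous u := continuous_iff_continuousAt.2 fun t => (hu t).continuousAt
  have h := norm_sub_le_integral_of_hasDerivAt (f := fun t => ‖u t‖ ^ 2)
    (f' := fun t => 2 * inner ℝ (u t) (u' t))
    (g := fun t => α * ‖u t‖ ^ 2 + α⁻¹ * ‖u' t‖ ^ 2)
    (fun t => (hu t).norm_sq) (by fun_prop) (by fun_prop) (fun t => ?_) hx hy
  · rw [intervalIntegral.integral_add (Continuous.intervalIntegrable (by fun_prop) _ _)
      (Continuous.intervalIntegrable (by fun_prop) _ _), intervalIntegral.integral_const_mul,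
      intervalIntegral.integral_const_mul] at h
    have := (le_abs_self _).trans h
    linarith
  · have h1 := abs_real_inner_le_norm (u t) (u' t)
    rw [norm_mul, Real.norm_eq_abs, Real.norm_eq_abs, abs_two]
    have h2 : 2 * (‖u t‖ * ‖u' t‖) ≤ α * ‖u t‖ ^ 2 + α⁻¹ * ‖u' t‖ ^ 2 := by
      have : 0 ≤ α⁻¹ * (α * ‖u t‖ - ‖u' t‖) ^ 2 := by positivity
      have e : α⁻¹ * (α * ‖u t‖ - ‖u' t‖) ^ 2
          = α * ‖u t‖ ^ 2 + α⁻¹ * ‖u' t‖ ^ 2 - 2 * (‖u t‖ * ‖u' t‖) := by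
        field_simp
        ring
      linarith
    linarith

lemma normSq_le_two_mul_add_integral (hu : ∀ t, HasDerivAt u (u' t) t) (hu' : Continuous u')
    (hx : x ∈ Set.Icc a c) (hy : y ∈ Set.Icc a c) :
    ‖u x‖ ^ 2 ≤ 2 * ‖u y‖ ^ 2 + 2 * (c - a) * ∫ t in a..c, ‖u' t‖ ^ 2 := by
  have hac : a ≤ c := hx.1.trans hx.2
  set K := ∫ t in a..c, ‖u' t‖ ^ 2 with hK
  have hK0 : 0 ≤ K := intervalIntegral.integral_nonneg hac fun t _ => by positivity
  set d := ‖u x - u y‖ with hd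
  have hd0 : 0 ≤ d := norm_nonneg _
  have hβ : ∀ β : ℝ, 0 < β → d ≤ β / 2 * (c - a) + (2 * β)⁻¹ * K := by
    intro β hβ
    have h := norm_sub_le_integral_of_hasDerivAt (g := fun t => β / 2 + (2 * β)⁻¹ * ‖u' t‖ ^ 2)
      hu hu' (by fun_prop) (fun t => ?_) hx hy
    · rw [intervalIntegral.integral_add (Continuous.intervalIntegrable (by fun_prop) _ _)
        (Continuous.intervalIntegrable (by fun_prop) _ _), intervalIntegral.integral_const_mul,
        intervalIntegral.integral_const, smul_eq_mul] at h
      linarith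
    · have : 0 ≤ (2 * β)⁻¹ * (β - ‖u' t‖) ^ 2 := by positivity
      have e : (2 * β)⁻¹ * (β - ‖u' t‖) ^ 2 = β / 2 + (2 * β)⁻¹ * ‖u' t‖ ^ 2 - ‖u' t‖ := by
        field_simp
        ring
      linarith
  have hsq : d ^ 2 ≤ (c - a) * K := by
    rcases hd0.eq_or_lt with h0 | h0
    · rw [← h0]
      have := mul_nonneg (sub_nonneg.2 hac) hK0
      simpa using this
    · have hL : 0 < c - a := by
        rcases hac.eq_or_lt with h | h
        · exfalso
          have : x = y := le_antisymm (by linarith [hx.2, hy.1]) (by linarith [hx.1, hy.2])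
          simp [hd, this] at h0
        · linarith
      have h := hβ (d / (c - a)) (by positivity)
      have e : d / (c - a) / 2 * (c - a) + (2 * (d / (c - a)))⁻¹ * K
          = (d ^ 2 + (c - a) * K) / (2 * d) := by
        field_simp
      rw [e, le_div_iff₀ (by positivity)] at h
      nlinarith
  have htri : ‖u x‖ ≤ ‖u y‖ + d := by
    simpa [add_comm] using norm_le_norm_add_norm_sub' (u x) (u y)
  nlinarith [norm_nonneg (u x), norm_nonneg (u y), sq_nonneg (‖u y‖ - d)]

end Interval

section Blocks

variable {ρ κ δ : ℝ → ℝ} {η b s : ℝ}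

/-- Control of `∫ ρ³` over an interval on which `ρ` oscillates little. -/
lemma integral_cube_le {a c M r K : ℝ} (hac : a ≤ c) (hρ : Continuous ρ) (hρ0 : ∀ t, 0 ≤ ρ t)
    (hM : ∫ t in a..c, ρ t ≤ M) (hM0 : 0 < M) (hr : 0 ≤ r) (hK : 0 ≤ K)
    (hosc : ∀ x ∈ Set.Icc a c, ∀ α : ℝ, 0 < α → ρ x ≤ r + α * M + α⁻¹ * K) :
    ∫ t in a..c, ρ t ^ 3 ≤ M * (2 * r ^ 2 + 8 * M * K) := by
  have hsup : ∀ x ∈ Set.Icc a c, ρ x ^ 2 ≤ 2 * r ^ 2 + 8 * M * K := by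
    intro x hx
    have hMK : 0 ≤ M * K := by positivity
    rcases le_or_gt (ρ x) r with h | h
    · nlinarith [hρ0 x]
    · set v := ρ x - r with hv
      have hv0 : 0 < v := by linarith
      have h1 := hosc x hx (v / (2 * M)) (by positivity)
      have e : r + v / (2 * M) * M + (v / (2 * M))⁻¹ * K = r + v / 2 + 2 * M * K / v := by
        field_simp
      rw [e] at h1
      have h2 : v / 2 ≤ 2 * M * K / v := by linarith
      rw [le_div_iff₀ hv0] at h2
      have : ρ x = r + v := by ring
      rw [this]
      nlinarith [sq_nonneg (r - v)]
  calc ∫ t in a..c, ρ t ^ 3 ≤ ∫ t in a..c, (2 * r ^ 2 + 8 * M * K) * ρ t :=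
        intervalIntegral.integral_mono_on hac (Continuous.intervalIntegrable (by fun_prop) _ _)
          (Continuous.intervalIntegrable (by fun_prop) _ _) fun x hx => by
            have := mul_le_mul_of_nonneg_right (hsup x hx) (hρ0 x)
            linarith [show ρ x ^ 3 = ρ x ^ 2 * ρ x by ring]
    _ = (2 * r ^ 2 + 8 * M * K) * ∫ t in a..c, ρ t := intervalIntegral.integral_const_mul _ _
    _ ≤ (2 * r ^ 2 + 8 * M * K) * M := mul_le_mul_of_nonneg_left hM (by positivity)
    _ = _ := mul_comm _ _

/-- A local uncertainty principle and a local exclusion principle for the density `ρ` imply a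
global kinetic energy inequality: cut the line into consecutive blocks carrying mass two. -/
lemma integral_cube_le_of_local_exclusion (hη : 0 < η) (hb : 0 < b)
    (hs0 : 0 ≤ s) (hs : s ≤ 5 / 2) (hsb : s ≤ 2 * η / b)
    (hρ : Continuous ρ) (hρ0 : ∀ t, 0 ≤ ρ t) (hκ : Integrable κ) (hκ0 : ∀ t, 0 ≤ κ t)
    (hδ : Integrable δ) (hδ0 : ∀ t, 0 ≤ δ t)
    (hunc : ∀ a c : ℝ, ∀ x ∈ Set.Icc a c, ∀ y ∈ Set.Icc a c, ∀ α : ℝ, 0 < α →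
      ρ x ≤ ρ y + α * (∫ t in a..c, ρ t) + α⁻¹ * ∫ t in a..c, κ t)
    (hexc : ∀ a c : ℝ, a ≤ c → (∫ t in a..c, ρ t) - 1
      ≤ 2 * (c - a) ^ 2 * (∫ t in a..c, κ t) + 4 * (c - a) * ∫ t in a..c, δ t)
    (havg : ∀ a c : ℝ, a ≤ c → ∫ t in a..c, ρ t ≤ b * (c - a))
    {R : ℝ} (hR : ρ R = 0) (n : ℕ) :
    ∀ a ≤ R, ∫ t in a..R, ρ t ≤ 2 * n →
      s * ∫ t in a..R, ρ t ^ 3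
        ≤ 320 * ((1 / 2) * (∫ t in a..R, κ t) + 2 * η * ∫ t in a..R, δ t) := by
  have hκi : ∀ a c, IntervalIntegrable κ volume a c := fun a c => hκ.intervalIntegrable
  have hδi : ∀ a c, IntervalIntegrable δ volume a c := fun a c => hδ.intervalIntegrable
  have hρi : ∀ a c, IntervalIntegrable ρ volume a c := fun a c => hρ.intervalIntegrable _ _
  have hρ3i : ∀ a c, IntervalIntegrable (fun t => ρ t ^ 3) volume a c :=
    fun a c => Continuous.intervalIntegrable (by fun_prop) _ _
  have tail : ∀ a ≤ R, ∫ t in a..R, ρ t ≤ 2 → s * ∫ t in a..R, ρ t ^ 3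
        ≤ 320 * ((1 / 2) * (∫ t in a..R, κ t) + 2 * η * ∫ t in a..R, δ t) := by
    intro a ha hm
    have hK : 0 ≤ ∫ t in a..R, κ t := intervalIntegral.integral_nonneg ha fun t _ => hκ0 t
    have hD : 0 ≤ ∫ t in a..R, δ t := intervalIntegral.integral_nonneg ha fun t _ => hδ0 t
    have h := integral_cube_le ha hρ hρ0 hm two_pos le_rfl hK fun x hx α hα => by
      have h1 := hunc a R x hx R ⟨ha, le_rfl⟩ α hα
      have h2 := mul_le_mul_of_nonneg_left hm hα.le
      linarith
    have h' := mul_le_mul_of_nonneg_left h hs0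
    have h'' := mul_le_mul_of_nonneg_right hs hK
    have := mul_nonneg hη.le hD
    nlinarith
  have block : ∀ a c, a < c → ∫ t in a..c, ρ t = 2 → s * ∫ t in a..c, ρ t ^ 3
        ≤ 320 * ((1 / 2) * (∫ t in a..c, κ t) + 2 * η * ∫ t in a..c, δ t) := by
    intro a c hac hm
    set L := c - a with hLdef
    have hL : 0 < L := sub_pos.2 hac
    set K := ∫ t in a..c, κ t with hKdef
    set D := ∫ t in a..c, δ t with hDdef
    have hK : 0 ≤ K := intervalIntegral.integral_nonneg hac.le fun t _ => hκ0 t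
    have hD : 0 ≤ D := intervalIntegral.integral_nonneg hac.le fun t _ => hδ0 t
    obtain ⟨y, hy, hyle⟩ : ∃ y ∈ Set.Icc a c, ρ y ≤ 2 / L := by
      by_contra! hcon
      have : ∫ t in a..c, 2 / L < ∫ t in a..c, ρ t :=
        intervalIntegral.integral_lt_integral_of_continuousOn_of_le_of_exists_lt hac
          continuousOn_const hρ.continuousOn (fun t ht => (hcon t ⟨ht.1.le, ht.2⟩).le)
          ⟨a, ⟨le_rfl, hac.le⟩, hcon a ⟨le_rfl, hac.le⟩⟩
      rw [hm, intervalIntegral.integral_const, smul_eq_mul, ← hLdef] at this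
      field_simp at this
      exact lt_irrefl _ this
    have h := integral_cube_le (r := 2 / L) (K := K) hac.le hρ hρ0 hm.le two_pos (by positivity) hK
      fun x hx α hα => by
        have h1 := hunc a c x hx y hy α hα
        rw [hm] at h1
        linarith
    have hex := hexc a c hac.le
    rw [hm, ← hLdef, ← hKdef, ← hDdef] at hex
    have hbL := havg a c hac.le
    rw [hm, ← hLdef] at hbL
    have hsL : s ≤ η * L := hsb.trans <| by
      rw [div_le_iff₀ hb]
      nlinarith
    have hsL2 : s / L ^ 2 ≤ 5 * K + 4 * η * D := by
      rw [div_le_iff₀ (by positivity)]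
      have h1 := mul_le_mul_of_nonneg_left hex hs0
      have h2 : s * (2 * L ^ 2 * K) ≤ 5 / 2 * (2 * L ^ 2 * K) :=
        mul_le_mul_of_nonneg_right hs (by positivity)
      have h3 : s * (4 * L * D) ≤ η * L * (4 * L * D) :=
        mul_le_mul_of_nonneg_right hsL (by positivity)
      nlinarith
    have h1 := mul_le_mul_of_nonneg_left h hs0
    have h2 : s * (2 * (2 * (2 / L) ^ 2 + 8 * 2 * K)) = 16 * (s / L ^ 2) + 32 * (s * K) := by
      field_simp
      ring
    have h3 : s * K ≤ 5 / 2 * K := mul_le_mul_of_nonneg_right hs hK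
    have := mul_nonneg hη.le hD
    nlinarith
  induction n with
  | zero => exact fun a ha hm => tail a ha (hm.trans (by norm_num))
  | succ n ih =>
    intro a ha hm
    rcases le_or_gt (∫ t in a..R, ρ t) 2 with h2 | h2
    · exact tail a ha h2
    obtain ⟨c, hc, hcm⟩ : (2 : ℝ) ∈ (fun c => ∫ t in a..c, ρ t) '' Set.Icc a R :=
      intermediate_value_Icc ha
        (intervalIntegral.continuous_primitive hρi a).continuousOn
        ⟨by simp, h2.le⟩
    simp only at hcm
    have hac : a < c := lt_of_le_of_ne hc.1 fun h => by simp [← h] at hcm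
    have hadd := intervalIntegral.integral_add_adjacent_intervals (hρi a c) (hρi c R)
    have hi := ih c hc.2 (by push_cast at hm; linarith)
    have hb' := block a c hac hcm
    rw [← intervalIntegral.integral_add_adjacent_intervals (hρ3i a c) (hρ3i c R),
      ← intervalIntegral.integral_add_adjacent_intervals (hκi a c) (hκi c R),
      ← intervalIntegral.integral_add_adjacent_intervals (hδi a c) (hδi c R)]
    linarith

end Blocks

section Coordinates

variable {ι : Type*} [DecidableEq ι]

/-- The point whose `j`-th coordinate is `t` and whose remaining coordinates are given by `z`. -/
def insertCoord (j : ι) (t : ℝ) (z : {k : ι // k ≠ j} → ℝ) : ι → ℝ :=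
  fun k => if h : k = j then t else z ⟨k, h⟩

@[simp] lemma insertCoord_self (j : ι) (t : ℝ) (z : {k : ι // k ≠ j} → ℝ) :
    insertCoord j t z j = t := by
  simp [insertCoord]

@[simp] lemma insertCoord_val (j : ι) (t : ℝ) (z : {k : ι // k ≠ j} → ℝ) (k : {k : ι // k ≠ j}) :
    insertCoord j t z k = z k := by
  simp [insertCoord, k.2]

lemma insertCoord_restrict (j : ι) (x : ι → ℝ) : insertCoord j (x j) (fun k => x k) = x := by
  ext k
  by_cases h : k = j
  · subst h; simp
  · simp [insertCoord, h]

lemma continuous_insertCoord (j : ι) :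
    Continuous fun p : ℝ × ({k : ι // k ≠ j} → ℝ) => insertCoord j p.1 p.2 := by
  refine continuous_pi fun k => ?_
  by_cases h : k = j
  · simp only [insertCoord, h, dite_true]
    fun_prop
  · simp only [insertCoord, h, dite_false]
    fun_prop

/-- Splitting off the `j`-th coordinate. -/
def insertCoordEquiv (j : ι) : ℝ × ({k : ι // k ≠ j} → ℝ) ≃ᵐ (ι → ℝ) where
  toFun p := insertCoord j p.1 p.2
  invFun x := (x j, fun k => x k)
  left_inv p := by ext <;> simp
  right_inv x := insertCoord_restrict j x
  measurable_toFun := by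
    change Measurable fun p : ℝ × ({k : ι // k ≠ j} → ℝ) => insertCoord j p.1 p.2
    refine measurable_pi_lambda _ fun k => ?_
    by_cases h : k = j
    · simp only [insertCoord, h, dite_true]
      fun_prop
    · simp only [insertCoord, h, dite_false]
      fun_prop
  measurable_invFun := by
    change Measurable fun x : ι → ℝ => (x j, fun k : {k : ι // k ≠ j} => x k)
    fun_prop

variable [Fintype ι]

lemma measurePreserving_insertCoordEquiv (j : ι) :
    MeasurePreserving (insertCoordEquiv j) := by
  have h1 := (volume_preserving_piEquivPiSubtypeProd (fun _ : ι => ℝ) (fun k => k = j)).symm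
  have h2 := (volume_preserving_funUnique {k : ι // k = j} ℝ).symm.prod
    (MeasurePreserving.id (volume : Measure ({k : ι // k ≠ j} → ℝ)))
  refine h1.comp (μa := volume.prod volume)
    (f := Prod.map (MeasurableEquiv.funUnique {k : ι // k = j} ℝ).symm id) ?_
  convert h2
  rw [Measure.volume_eq_prod]
  congr!

lemma integral_eq_integral_insertCoord {f : (ι → ℝ) → ℝ} (hf : Integrable f) (j : ι) :
    ∫ x, f x = ∫ t, ∫ z, f (insertCoord j t z) := by
  rw [← (measurePreserving_insertCoordEquiv j).integral_comp' f]
  exact integral_prod _ ((measurePreserving_insertCoordEquiv j).integrable_comp_emb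
    (insertCoordEquiv j).measurableEmbedding |>.2 hf)

lemma integrable_insertCoord_iff {f : (ι → ℝ) → ℝ} (j : ι) :
    Integrable (fun p : ℝ × ({k : ι // k ≠ j} → ℝ) => f (insertCoord j p.1 p.2))
      (volume.prod volume) ↔ Integrable f :=
  (measurePreserving_insertCoordEquiv j).integrable_comp_emb
    (insertCoordEquiv j).measurableEmbedding

end Coordinates

lemma integral_comp_equiv {ι ι' : Type*} [Fintype ι] [Fintype ι'] (e : ι ≃ ι') (f : (ι → ℝ) → ℝ) :
    ∫ z : ι' → ℝ, f (z ∘ e) = ∫ z, f z := by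
  rw [← (volume_measurePreserving_piCongrLeft (fun _ : ι => ℝ) e.symm).integral_comp' f]
  congr with z
  congr 1 with k
  simp [MeasurableEquiv.coe_piCongrLeft, Equiv.piCongrLeft_apply]

lemma HasCompactSupport.integrable_norm_sq {ι : Type*} [Fintype ι] {φ : (ι → ℝ) → ℂ}
    (hc : Continuous φ) (hs : HasCompactSupport φ) : Integrable fun x => ‖φ x‖ ^ 2 :=
  Continuous.integrable_of_hasCompactSupport (by fun_prop)
    (hs.comp_left (g := fun w : ℂ => ‖w‖ ^ 2) (by simp))

section Density

variable {N : ℕ} {φ : (Fin N → ℝ) → ℂ}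

lemma densityAt_eq (φ : (Fin N → ℝ) → ℂ) (j : Fin N) (t : ℝ) :
    densityAt φ j t = ∫ z, ‖φ (insertCoord j t z)‖ ^ 2 := rfl

lemma densityAt_nonneg (φ : (Fin N → ℝ) → ℂ) (j : Fin N) (t : ℝ) : 0 ≤ densityAt φ j t :=
  integral_nonneg fun _ => by positivity

lemma continuous_comp_insertCoord (hc : Continuous φ) (j : Fin N) :
    Continuous fun p : ℝ × ({k : Fin N // k ≠ j} → ℝ) => φ (insertCoord j p.1 p.2) :=
  hc.comp (continuous_insertCoord j)

lemma continuous_densityAt (hc : Continuous φ) (hs : HasCompactSupport φ)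
    (j : Fin N) : Continuous (densityAt φ j) := by
  have hK : IsCompact ((fun (x : Fin N → ℝ) (k : {k // k ≠ j}) => x k) '' tsupport φ) :=
    hs.isCompact.image (by fun_prop)
  rw [← continuousOn_univ]
  refine continuousOn_integral_of_compact_support hK (Continuous.continuousOn ?_) ?_
  · exact (continuous_comp_insertCoord hc j).norm.pow 2
  · intro t z _ hz
    have : φ (insertCoord j t z) = 0 := by
      refine image_eq_zero_of_notMem_tsupport fun h => hz ⟨_, h, ?_⟩
      ext k
      simp
    change ‖φ (insertCoord j t z)‖ ^ 2 = 0
    simp [this]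

lemma exists_densityAt_eq_zero (hs : HasCompactSupport φ) (j : Fin N) :
    ∃ R, 0 ≤ R ∧ ∀ t, R ≤ |t| → densityAt φ j t = 0 := by
  obtain ⟨R, hR⟩ := hs.isCompact.isBounded.exists_norm_le
  refine ⟨max R 0 + 1, by positivity, fun t ht => ?_⟩
  have h0 : ∀ z, φ (insertCoord j t z) = 0 := by
    intro z
    refine image_eq_zero_of_notMem_tsupport fun h => ?_
    have h1 := (norm_le_pi_norm (insertCoord j t z) j).trans (hR _ h)
    rw [insertCoord_self, Real.norm_eq_abs] at h1
    linarith [le_max_left R 0]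
  simp [densityAt_eq, h0]

lemma integrable_prod_norm_sq (hc : Continuous φ) (hs : HasCompactSupport φ)
    (j : Fin N) :
    Integrable (fun p : ℝ × ({k : Fin N // k ≠ j} → ℝ) => ‖φ (insertCoord j p.1 p.2)‖ ^ 2)
      (volume.prod volume) :=
  (integrable_insertCoord_iff (f := fun x => ‖φ x‖ ^ 2) j).2 (hs.integrable_norm_sq hc)

lemma integrable_densityAt (hc : Continuous φ) (hs : HasCompactSupport φ)
    (j : Fin N) : Integrable (densityAt φ j) :=
  (integrable_prod_norm_sq hc hs j).integral_prod_left

lemma integral_densityAt (hc : Continuous φ) (hs : HasCompactSupport φ)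
    (j : Fin N) : ∫ t, densityAt φ j t = ∫ x, ‖φ x‖ ^ 2 :=
  (integral_eq_integral_insertCoord (hs.integrable_norm_sq hc) j).symm

lemma integrable_norm_sq_insertCoord (hc : Continuous φ) (hs : HasCompactSupport φ)
    (j : Fin N) (t : ℝ) :
    Integrable fun z => ‖φ (insertCoord j t z)‖ ^ 2 := by
  have hcl : Topology.IsClosedEmbedding (insertCoord j t) :=
    Function.LeftInverse.isClosedEmbedding
      (f := fun (x : Fin N → ℝ) (k : {k // k ≠ j}) => x k) (fun z => by ext k; simp)
      (by fun_prop) ((continuous_insertCoord j).comp (Continuous.prodMk_right t))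
  exact (hs.comp_isClosedEmbedding hcl).integrable_norm_sq (hc.comp hcl.continuous)

lemma integrable_intervalIntegral_norm_sq (hc : Continuous φ) (hs : HasCompactSupport φ)
    (j : Fin N) {a c : ℝ} (hac : a ≤ c) :
    Integrable fun z => ∫ t in a..c, ‖φ (insertCoord j t z)‖ ^ 2 := by
  simp_rw [intervalIntegral.integral_of_le hac]
  refine Integrable.integral_prod_right
    (f := fun p : ℝ × ({k : Fin N // k ≠ j} → ℝ) => ‖φ (insertCoord j p.1 p.2)‖ ^ 2)
    (μ := volume.restrict (Set.Ioc a c)) ?_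
  exact (integrable_prod_norm_sq hc hs j).mono_measure
    (Measure.prod_mono Measure.restrict_le_self le_rfl)

lemma intervalIntegral_densityAt (hc : Continuous φ) (hs : HasCompactSupport φ)
    (j : Fin N) {a c : ℝ} (hac : a ≤ c) :
    ∫ t in a..c, densityAt φ j t = ∫ z, ∫ t in a..c, ‖φ (insertCoord j t z)‖ ^ 2 := by
  simp_rw [intervalIntegral.integral_of_le hac, densityAt_eq]
  refine integral_integral_swap
    (f := fun (t : ℝ) (z : {k : Fin N // k ≠ j} → ℝ) => ‖φ (insertCoord j t z)‖ ^ 2) ?_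
  exact (integrable_prod_norm_sq hc hs j).mono_measure
    (Measure.prod_mono Measure.restrict_le_self le_rfl)

end Density

section Contact

variable {N : ℕ} {ψ : (Fin N → ℝ) → ℂ}

/-- `∫ |ψ|²` over all particle coordinates except the `j`-th and `k`-th, both set to `t`. -/
noncomputable def contactAt (ψ : (Fin N → ℝ) → ℂ) (j k : Fin N) (t : ℝ) : ℝ :=
  ∫ z : {l : Fin N // l ≠ j ∧ l ≠ k} → ℝ, ‖ψ (insertPair j k t z)‖ ^ 2

lemma contactAt_nonneg (ψ : (Fin N → ℝ) → ℂ) (j k : Fin N) (t : ℝ) : 0 ≤ contactAt ψ j k t :=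
  integral_nonneg fun _ => by positivity

lemma contactAt_comm (ψ : (Fin N → ℝ) → ℂ) (j k : Fin N) (t : ℝ) :
    contactAt ψ j k t = contactAt ψ k j t := by
  let e : {l : Fin N // l ≠ j ∧ l ≠ k} ≃ {l : Fin N // l ≠ k ∧ l ≠ j} :=
    Equiv.subtypeEquivRight fun _ => and_comm
  rw [contactAt, contactAt, ← integral_comp_equiv e]
  congr with z
  congr 3 with l
  simp only [insertPair, or_comm, Function.comp_apply]
  rfl

lemma insertCoord_insertCoord_eq_insertPair {j : Fin N} (k : {k : Fin N // k ≠ j}) (t : ℝ)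
    (e : {l : {l : Fin N // l ≠ j} // l ≠ k} ≃ {l : Fin N // l ≠ j ∧ l ≠ k})
    (he : ∀ l, (e l : Fin N) = l) (z : {l : Fin N // l ≠ j ∧ l ≠ k} → ℝ) :
    insertCoord j t (insertCoord k t (z ∘ e)) = insertPair j k t z := by
  ext l
  by_cases hj : l = j
  · simp [insertCoord, insertPair, hj]
  by_cases hk : l = k
  · simp [insertCoord, insertPair, hk]
  have hk' : (⟨l, hj⟩ : {l : Fin N // l ≠ j}) ≠ k := fun h => hk (congrArg Subtype.val h)
  simp only [insertCoord, insertPair, hj, hk, hk', dite_false, or_self, Function.comp_apply]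
  exact congrArg z (Subtype.ext (he _))

lemma contactAt_eq_integral_insertCoord (ψ : (Fin N → ℝ) → ℂ) {j : Fin N}
    (k : {k : Fin N // k ≠ j}) (t : ℝ) :
    contactAt ψ j k t = ∫ w, ‖ψ (insertCoord j t (insertCoord k t w))‖ ^ 2 := by
  let e : {l : {l : Fin N // l ≠ j} // l ≠ k} ≃ {l : Fin N // l ≠ j ∧ l ≠ k} :=
    { toFun := fun l => ⟨l.1.1, l.1.2, fun h => l.2 (Subtype.ext h)⟩
      invFun := fun l => ⟨⟨l.1, l.2.1⟩, fun h => l.2.2 (congrArg Subtype.val h)⟩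
      left_inv := fun _ => rfl
      right_inv := fun _ => rfl }
  rw [← integral_comp_equiv e, contactAt]
  simp_rw [insertCoord_insertCoord_eq_insertPair k t e fun _ => rfl]

lemma integrable_norm_sq_insertCoord_diag (hc : Continuous ψ) (hs : HasCompactSupport ψ)
    {j : Fin N} (k : {k : Fin N // k ≠ j}) :
    Integrable fun z : {k : Fin N // k ≠ j} → ℝ => ‖ψ (insertCoord j (z k) z)‖ ^ 2 := by
  have hcl : Topology.IsClosedEmbedding
      fun z : {k : Fin N // k ≠ j} → ℝ => insertCoord j (z k) z :=
    Function.LeftInverse.isClosedEmbedding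
      (f := fun (x : Fin N → ℝ) (k : {k // k ≠ j}) => x k) (fun z => by ext k; simp)
      (by fun_prop) ((continuous_insertCoord j).comp (by fun_prop :
        Continuous fun z : {k : Fin N // k ≠ j} → ℝ => (z k, z)))
  exact (hs.comp_isClosedEmbedding hcl).integrable_norm_sq (hc.comp hcl.continuous)

lemma integrable_contactAt (hc : Continuous ψ) (hs : HasCompactSupport ψ) {j k : Fin N}
    (hjk : k ≠ j) : Integrable (contactAt ψ j k) := by
  have h := ((integrable_insertCoord_iff (⟨k, hjk⟩ : {k : Fin N // k ≠ j})).2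
    (integrable_norm_sq_insertCoord_diag hc hs ⟨k, hjk⟩)).integral_prod_left
  refine h.congr (Filter.Eventually.of_forall fun t => ?_)
  simp only [insertCoord_self]
  exact (contactAt_eq_integral_insertCoord ψ ⟨k, hjk⟩ t).symm

lemma integral_indicator_contact (hc : Continuous ψ) (hs : HasCompactSupport ψ) {j : Fin N}
    (k : {k : Fin N // k ≠ j}) {a c : ℝ} (hac : a ≤ c) :
    ∫ z, Set.indicator {z : {k : Fin N // k ≠ j} → ℝ | z k ∈ Set.Ioc a c}
      (fun z => ‖ψ (insertCoord j (z k) z)‖ ^ 2) z = ∫ t in a..c, contactAt ψ j k t := by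
  have hm : MeasurableSet {z : {k : Fin N // k ≠ j} → ℝ | z k ∈ Set.Ioc a c} :=
    measurableSet_Ioc.preimage (measurable_pi_apply k)
  rw [integral_eq_integral_insertCoord
    ((integrable_norm_sq_insertCoord_diag hc hs k).indicator hm) k,
    intervalIntegral.integral_of_le hac, ← integral_indicator measurableSet_Ioc]
  congr with t
  by_cases ht : t ∈ Set.Ioc a c
  · simp only [Set.indicator_apply, Set.mem_ofPred_eq, insertCoord_self, ht, if_true]
    exact (contactAt_eq_integral_insertCoord ψ k t).symm
  · simp only [Set.indicator_apply, Set.mem_ofPred_eq, insertCoord_self, ht, if_false,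
      integral_zero]

end Contact

section Exclusion

variable {N : ℕ} {ψ : (Fin N → ℝ) → ℂ}

/-- The `j`-th partial derivative. -/
noncomputable def partialDeriv (ψ : (Fin N → ℝ) → ℂ) (j : Fin N) (x : Fin N → ℝ) : ℂ :=
  fderiv ℝ ψ x (Pi.single j 1)

lemma continuous_partialDeriv (hψ : ContDiff ℝ (⊤ : ℕ∞) ψ) (j : Fin N) :
    Continuous (partialDeriv ψ j) :=
  (hψ.continuous_fderiv (by simp)).clm_apply continuous_const

lemma HasCompactSupport.partialDeriv (hs : HasCompactSupport ψ) (j : Fin N) :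
    HasCompactSupport (partialDeriv ψ j) :=
  hs.fderiv_apply ℝ _

lemma hasDerivAt_comp_insertCoord (hψ : ContDiff ℝ (⊤ : ℕ∞) ψ) (j : Fin N)
    (z : {k : Fin N // k ≠ j} → ℝ) (t : ℝ) :
    HasDerivAt (fun t => ψ (insertCoord j t z)) (partialDeriv ψ j (insertCoord j t z)) t := by
  refine HasFDerivAt.comp_hasDerivAt t
    (hψ.differentiable (by simp) (insertCoord j t z)).hasFDerivAt (hasDerivAt_pi.2 fun k => ?_)
  by_cases h : k = j
  · subst h
    simpa using hasDerivAt_id' t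
  · simpa [insertCoord, h] using hasDerivAt_const t _

lemma continuous_slice {φ : (Fin N → ℝ) → ℂ} (hc : Continuous φ) (j : Fin N)
    (z : {k : Fin N // k ≠ j} → ℝ) : Continuous fun t => φ (insertCoord j t z) :=
  (continuous_comp_insertCoord hc j).comp (Continuous.prodMk_left z)

lemma densityAt_le_add (hψ : ContDiff ℝ (⊤ : ℕ∞) ψ) (hs : HasCompactSupport ψ) (j : Fin N)
    {a c x y α : ℝ} (hx : x ∈ Set.Icc a c) (hy : y ∈ Set.Icc a c) (hα : 0 < α) :
    densityAt ψ j x ≤ densityAt ψ j y + α * (∫ t in a..c, densityAt ψ j t)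
      + α⁻¹ * ∫ t in a..c, densityAt (partialDeriv ψ j) j t := by
  have hc := hψ.continuous
  have hc' := continuous_partialDeriv hψ j
  have hs' := hs.partialDeriv j
  have hac := hx.1.trans hx.2
  have i1 := integrable_norm_sq_insertCoord hc hs j y
  have i2 := (integrable_intervalIntegral_norm_sq hc hs j hac).const_mul α
  have i3 := (integrable_intervalIntegral_norm_sq hc' hs' j hac).const_mul α⁻¹
  rw [intervalIntegral_densityAt hc hs j hac, intervalIntegral_densityAt hc' hs' j hac,
    densityAt_eq, densityAt_eq, ← integral_const_mul, ← integral_const_mul,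
    ← integral_add i1 i2]
  refine le_of_le_of_eq ?_ (integral_add (i1.add i2) i3)
  exact integral_mono (integrable_norm_sq_insertCoord hc hs j x) ((i1.add i2).add i3)
    fun z => normSq_le_add_integral (hasDerivAt_comp_insertCoord hψ j z)
      (continuous_slice hc' j z) hx hy hα

/-- Configurations in which particle `j` shares the interval `(a, c]` with another particle. -/
def sharedSet (a c : ℝ) (j : Fin N) : Set (Fin N → ℝ) :=
  {x | x j ∈ Set.Ioc a c ∧ ∃ k : {k : Fin N // k ≠ j}, x k ∈ Set.Ioc a c}

lemma measurableSet_sharedSet (a c : ℝ) (j : Fin N) : MeasurableSet (sharedSet a c j) := by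
  have h : ∀ k : Fin N, MeasurableSet {x : Fin N → ℝ | x k ∈ Set.Ioc a c} := fun k =>
    measurableSet_Ioc.preimage (measurable_pi_apply k)
  have : sharedSet a c j = {x | x j ∈ Set.Ioc a c} ∩
      ⋃ k : {k : Fin N // k ≠ j}, {x : Fin N → ℝ | x k ∈ Set.Ioc a c} := by
    ext x
    simp [sharedSet]
  rw [this]
  exact (h j).inter (MeasurableSet.iUnion fun k => h k)

lemma integral_sharedSet_slice_le (hψ : ContDiff ℝ (⊤ : ℕ∞) ψ) (j : Fin N)
    {a c : ℝ} (hac : a ≤ c) (z : {k : Fin N // k ≠ j} → ℝ) :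
    ∫ t, (sharedSet a c j).indicator (fun x => ‖ψ x‖ ^ 2) (insertCoord j t z)
      ≤ 2 * (c - a) * ∑ k, Set.indicator {z : {k : Fin N // k ≠ j} → ℝ | z k ∈ Set.Ioc a c}
          (fun z => ‖ψ (insertCoord j (z k) z)‖ ^ 2) z
        + 2 * (c - a) ^ 2 * ∫ t in a..c, ‖partialDeriv ψ j (insertCoord j t z)‖ ^ 2 := by
  set K := ∫ t in a..c, ‖partialDeriv ψ j (insertCoord j t z)‖ ^ 2 with hK
  have hK0 : 0 ≤ K := intervalIntegral.integral_nonneg hac fun t _ => by positivity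
  have hL : 0 ≤ c - a := sub_nonneg.2 hac
  have hterm : ∀ k : {k : Fin N // k ≠ j},
      0 ≤ Set.indicator {z : {k : Fin N // k ≠ j} → ℝ | z k ∈ Set.Ioc a c}
        (fun z => ‖ψ (insertCoord j (z k) z)‖ ^ 2) z :=
    fun k => Set.indicator_nonneg (fun _ _ => by positivity) _
  by_cases h : ∃ k : {k : Fin N // k ≠ j}, z k ∈ Set.Ioc a c
  · obtain ⟨k, hk⟩ := h
    have e : ∀ t, (sharedSet a c j).indicator (fun x => ‖ψ x‖ ^ 2) (insertCoord j t z)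
        = (Set.Ioc a c).indicator (fun t => ‖ψ (insertCoord j t z)‖ ^ 2) t := by
      intro t
      have : insertCoord j t z ∈ sharedSet a c j ↔ t ∈ Set.Ioc a c := by
        simp only [sharedSet, Set.mem_ofPred_eq, insertCoord_self, insertCoord_val]
        exact ⟨fun h => h.1, fun h => ⟨h, k, hk⟩⟩
      by_cases ht : t ∈ Set.Ioc a c
      · rw [Set.indicator_of_mem ht, Set.indicator_of_mem (this.2 ht)]
      · rw [Set.indicator_of_notMem ht, Set.indicator_of_notMem (mt this.1 ht)]
    simp_rw [e]
    rw [integral_indicator measurableSet_Ioc, ← intervalIntegral.integral_of_le hac]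
    have h1 : ∫ t in a..c, ‖ψ (insertCoord j t z)‖ ^ 2
        ≤ ∫ t in a..c, (2 * ‖ψ (insertCoord j (z k) z)‖ ^ 2 + 2 * (c - a) * K) :=
      intervalIntegral.integral_mono_on hac
        (((continuous_slice hψ.continuous j z).norm.pow 2).intervalIntegrable _ _)
        intervalIntegrable_const fun t ht =>
          normSq_le_two_mul_add_integral (hasDerivAt_comp_insertCoord hψ j z)
            (continuous_slice (continuous_partialDeriv hψ j) j z) ht ⟨hk.1.le, hk.2⟩
    rw [intervalIntegral.integral_const, smul_eq_mul] at h1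
    have h2 := Finset.single_le_sum (fun k _ => hterm k) (Finset.mem_univ k)
    rw [Set.indicator_of_mem (show z ∈ {z : {k : Fin N // k ≠ j} → ℝ | z k ∈ Set.Ioc a c}
      from hk)] at h2
    have h3 := mul_le_mul_of_nonneg_left h2 (by positivity : 0 ≤ 2 * (c - a))
    nlinarith
  · have e : ∀ t, (sharedSet a c j).indicator (fun x => ‖ψ x‖ ^ 2) (insertCoord j t z) = 0 := by
      intro t
      refine Set.indicator_of_notMem (fun hmem => h ?_) _
      simpa using hmem.2
    simp_rw [e, integral_zero]
    have := Finset.sum_nonneg fun k (_ : k ∈ Finset.univ) => hterm k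
    positivity

lemma integral_sharedSet_le (hψ : ContDiff ℝ (⊤ : ℕ∞) ψ) (hs : HasCompactSupport ψ) (j : Fin N)
    {a c : ℝ} (hac : a ≤ c) :
    ∫ x, (sharedSet a c j).indicator (fun x => ‖ψ x‖ ^ 2) x
      ≤ 2 * (c - a) * (∑ k : {k : Fin N // k ≠ j}, ∫ t in a..c, contactAt ψ j k t)
        + 2 * (c - a) ^ 2 * ∫ t in a..c, densityAt (partialDeriv ψ j) j t := by
  have hc := hψ.continuous
  have hc' := continuous_partialDeriv hψ j
  have hs' := hs.partialDeriv j
  have hint := (integrable_insertCoord_iff j).2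
    ((hs.integrable_norm_sq hc).indicator (measurableSet_sharedSet a c j))
  have hki : ∀ k : {k : Fin N // k ≠ j}, Integrable
      (Set.indicator {z : {k : Fin N // k ≠ j} → ℝ | z k ∈ Set.Ioc a c}
        (fun z => ‖ψ (insertCoord j (z k) z)‖ ^ 2)) := fun k =>
    (integrable_norm_sq_insertCoord_diag hc hs k).indicator
      (measurableSet_Ioc.preimage (measurable_pi_apply k))
  have i1 := (integrable_finsetSum Finset.univ fun k _ => hki k).const_mul (2 * (c - a))
  have i2 := (integrable_intervalIntegral_norm_sq hc' hs' j hac).const_mul (2 * (c - a) ^ 2)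
  simp_rw [← integral_indicator_contact hc hs _ hac]
  rw [intervalIntegral_densityAt hc' hs' j hac, ← integral_finsetSum _ fun k _ => hki k,
    ← integral_const_mul, ← integral_const_mul, ← integral_add i1 i2,
    ← (measurePreserving_insertCoordEquiv j).integral_comp']
  refine (integral_prod_symm _ hint).trans_le ?_
  exact integral_mono hint.integral_prod_right (i1.add i2)
    fun z => integral_sharedSet_slice_le hψ j hac z

lemma integral_mul_norm_sq (j : Fin N) {g : ℝ → ℝ}
    (hg : Integrable fun x : Fin N → ℝ => g (x j) * ‖ψ x‖ ^ 2) :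
    ∫ x : Fin N → ℝ, g (x j) * ‖ψ x‖ ^ 2 = ∫ t, g t * densityAt ψ j t := by
  rw [integral_eq_integral_insertCoord hg j]
  simp_rw [insertCoord_self, integral_const_mul, densityAt_eq]

lemma sum_indicator_sub_one_le (a c : ℝ) (x : Fin N → ℝ) :
    (∑ j, (Set.Ioc a c).indicator 1 (x j)) - 1
      ≤ ∑ j, (sharedSet a c j).indicator (1 : (Fin N → ℝ) → ℝ) x := by
  by_cases h : ∃ i, (sharedSet a c i).indicator (1 : (Fin N → ℝ) → ℝ) x ≠ 0
  · obtain ⟨i, hi⟩ := h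
    obtain ⟨hi, k, hk⟩ := Set.mem_of_indicator_ne_zero hi
    have : ∀ j, (Set.Ioc a c).indicator (1 : ℝ → ℝ) (x j)
        ≤ (sharedSet a c j).indicator (1 : (Fin N → ℝ) → ℝ) x := by
      intro j
      by_cases hj : x j ∈ Set.Ioc a c
      · have hmem : x ∈ sharedSet a c j := by
          refine ⟨hj, ?_⟩
          by_cases hij : i = j
          · subst hij
            exact ⟨k, hk⟩
          · exact ⟨⟨i, hij⟩, hi⟩
        simp [hj, hmem]
      · rw [Set.indicator_of_notMem hj]
        exact Set.indicator_nonneg (fun _ _ => zero_le_one) _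
    linarith [Finset.sum_le_sum fun j (_ : j ∈ Finset.univ) => this j]
  · push Not at h
    simp_rw [h, Finset.sum_const_zero, sub_nonpos]
    by_cases h1 : ∃ i, x i ∈ Set.Ioc a c
    · obtain ⟨i, hi⟩ := h1
      rw [Finset.sum_eq_single i]
      · simp [hi]
      · intro j _ hji
        refine Set.indicator_of_notMem (fun hj => ?_) _
        have : x ∈ sharedSet a c i := ⟨hi, ⟨j, hji⟩, hj⟩
        have := h i
        simp_all
      · simp
    · push Not at h1
      rw [Finset.sum_eq_zero fun i _ => Set.indicator_of_notMem (h1 i) _]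
      exact zero_le_one

lemma sum_subtype_ne_eq_two_mul {f : Fin N → Fin N → ℝ} (hf : ∀ j k, f j k = f k j) :
    ∑ j, ∑ k : {k : Fin N // k ≠ j}, f j k
      = 2 * ∑ j, ∑ k ∈ Finset.univ.filter (fun k => j < k), f j k := by
  have h1 : ∀ j, ∑ k : {k : Fin N // k ≠ j}, f j k
      = (∑ k, if j < k then f j k else 0) + ∑ k, if k < j then f j k else 0 := by
    intro j
    rw [← Finset.sum_subtype (Finset.univ.filter fun k => k ≠ j) (by simp) (f j),
      Finset.sum_filter, ← Finset.sum_add_distrib]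
    refine Finset.sum_congr rfl fun k _ => ?_
    rcases lt_trichotomy j k with h | h | h
    · simp [h, h.ne', h.not_gt]
    · simp [h]
    · simp [h, h.ne, h.not_gt]
  simp_rw [h1, Finset.sum_add_distrib, Finset.sum_filter]
  rw [Finset.sum_comm (f := fun j k => if k < j then f j k else 0), two_mul]
  simp_rw [hf]

/-- Local exclusion principle. -/
lemma sum_densityAt_sub_one_le (hψ : ContDiff ℝ (⊤ : ℕ∞) ψ) (hs : HasCompactSupport ψ)
    (hnorm : ∫ x : Fin N → ℝ, ‖ψ x‖ ^ 2 = 1) {a c : ℝ} (hac : a ≤ c) :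
    (∑ j, ∫ t in a..c, densityAt ψ j t) - 1
      ≤ 2 * (c - a) ^ 2 * (∑ j, ∫ t in a..c, densityAt (partialDeriv ψ j) j t)
        + 4 * (c - a) * ∑ j, ∑ k ∈ Finset.univ.filter (fun k => j < k),
            ∫ t in a..c, contactAt ψ j k t := by
  have hc := hψ.continuous
  have hF := hs.integrable_norm_sq hc
  have hi : ∀ j : Fin N, Integrable fun x : Fin N → ℝ =>
      (Set.Ioc a c).indicator (1 : ℝ → ℝ) (x j) * ‖ψ x‖ ^ 2 := by
    intro j
    refine (hF.indicator (measurableSet_Ioc.preimage (measurable_pi_apply j) :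
      MeasurableSet {x : Fin N → ℝ | x j ∈ Set.Ioc a c})).congr
        (Filter.Eventually.of_forall fun x => ?_)
    by_cases hx : x j ∈ Set.Ioc a c <;> simp [Set.indicator, Set.mem_preimage, -Set.mem_Ioc, hx]
  have hdens : ∀ j : Fin N, ∫ t in a..c, densityAt ψ j t
      = ∫ x : Fin N → ℝ, (Set.Ioc a c).indicator (1 : ℝ → ℝ) (x j) * ‖ψ x‖ ^ 2 := by
    intro j
    rw [integral_mul_norm_sq j (hi j), intervalIntegral.integral_of_le hac,
      ← integral_indicator measurableSet_Ioc]
    congr with t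
    simp [Set.indicator_apply]
  have hsh : ∀ j : Fin N, Integrable ((sharedSet a c j).indicator fun x => ‖ψ x‖ ^ 2) :=
    fun j => hF.indicator (measurableSet_sharedSet a c j)
  have hle : (∑ j, ∫ t in a..c, densityAt ψ j t) - 1
      ≤ ∑ j, ∫ x, (sharedSet a c j).indicator (fun x => ‖ψ x‖ ^ 2) x := by
    simp_rw [hdens]
    conv_lhs => rw [← hnorm]
    rw [← integral_finsetSum _ fun j _ => hi j, ← integral_finsetSum _ fun j _ => hsh j,
      ← integral_sub (integrable_finsetSum _ fun j _ => hi j) hF]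
    refine integral_mono ((integrable_finsetSum _ fun j _ => hi j).sub hF)
      (integrable_finsetSum _ fun j _ => hsh j) fun x => ?_
    have h := mul_le_mul_of_nonneg_right (sum_indicator_sub_one_le a c x)
      (by positivity : 0 ≤ ‖ψ x‖ ^ 2)
    rw [sub_mul, one_mul, Finset.sum_mul, Finset.sum_mul] at h
    refine h.trans_eq (Finset.sum_congr rfl fun j _ => ?_)
    by_cases hx : x ∈ sharedSet a c j <;> simp [hx]
  have hsum := Finset.sum_le_sum fun j (_ : j ∈ Finset.univ) => integral_sharedSet_le hψ hs j hac
  rw [Finset.sum_add_distrib, ← Finset.mul_sum, ← Finset.mul_sum,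
    sum_subtype_ne_eq_two_mul (f := fun j k => ∫ t in a..c, contactAt ψ j k t)
      (fun j k => by simp_rw [contactAt_comm ψ j k])] at hsum
  linarith

end Exclusion

lemma densityAt_eq_of_symmetric {N : ℕ} {ψ : (Fin N → ℝ) → ℂ}
    (hsym : ∀ (σ : Equiv.Perm (Fin N)) (x : Fin N → ℝ), ψ (x ∘ σ) = ψ x) (i j : Fin N) :
    densityAt ψ i = densityAt ψ j := by
  ext t
  let σ : Equiv.Perm (Fin N) := Equiv.swap i j
  let e : {k : Fin N // k ≠ j} ≃ {k : Fin N // k ≠ i} :=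
    σ.subtypeEquiv fun k => by simp [σ, Equiv.swap_apply_eq_iff]
  rw [densityAt_eq, densityAt_eq, ← integral_comp_equiv e]
  congr with w
  have : insertCoord j t (w ∘ e) = insertCoord i t w ∘ σ := by
    ext k
    by_cases h : k = j
    · subst h
      simp [σ]
    · have h' : σ k ≠ i := (e ⟨k, h⟩).2
      simp only [insertCoord, h, h', Function.comp_apply, dite_false]
      rfl
  rw [this, hsym]

section Kinetic

variable {N : ℕ} {ψ : (Fin N → ℝ) → ℂ}

lemma exists_sum_densityAt_eq_zero (hs : HasCompactSupport ψ) :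
    ∃ R, 0 ≤ R ∧ ∀ t, R ≤ |t| → ∑ j, densityAt ψ j t = 0 := by
  choose R hR0 hR using exists_densityAt_eq_zero hs
  refine ⟨∑ j, R j, Finset.sum_nonneg fun j _ => hR0 j, fun t ht =>
    Finset.sum_eq_zero fun j _ => hR j t (le_trans ?_ ht)⟩
  exact Finset.single_le_sum (fun j _ => hR0 j) (Finset.mem_univ j)

lemma hasCompactSupport_sum_densityAt (hs : HasCompactSupport ψ) :
    HasCompactSupport fun t => ∑ j, densityAt ψ j t := by
  obtain ⟨R, -, hR⟩ := exists_sum_densityAt_eq_zero hs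
  refine HasCompactSupport.intro (isCompact_Icc (a := -R) (b := R)) fun t ht => hR t ?_
  by_contra! h
  exact ht (Set.mem_Icc.2 (abs_le.1 h.le))

lemma continuous_sum_densityAt (hc : Continuous ψ) (hs : HasCompactSupport ψ) :
    Continuous fun t => ∑ j, densityAt ψ j t :=
  continuous_finsetSum _ fun j _ => continuous_densityAt hc hs j

lemma intervalIntegral_le_integral {f : ℝ → ℝ} (hf : Integrable f) (hf0 : ∀ t, 0 ≤ f t)
    {a c : ℝ} (hac : a ≤ c) : ∫ t in a..c, f t ≤ ∫ t, f t := by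
  rw [intervalIntegral.integral_of_le hac]
  exact setIntegral_le_integral hf (Filter.Eventually.of_forall hf0)

/-- The kinetic energy inequality: the interaction energy controls `∫ ρ³`. -/
lemma mul_integral_density_cube_le (hψ : ContDiff ℝ (⊤ : ℕ∞) ψ) (hs : HasCompactSupport ψ)
    (hnorm : ∫ x : Fin N → ℝ, ‖ψ x‖ ^ 2 = 1) {η b s : ℝ} (hη : 0 < η) (hb : 0 < b)
    (hs0 : 0 ≤ s) (hs1 : s ≤ 5 / 2) (hsb : s ≤ 2 * η / b)
    (havg : ∀ a c, a ≤ c → ∫ t in a..c, ∑ j, densityAt ψ j t ≤ b * (c - a)) :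
    s * ∫ t, (∑ j, densityAt ψ j t) ^ 3
      ≤ 320 * ((1 / 2) * (∑ j, ∫ t, densityAt (partialDeriv ψ j) j t)
        + 2 * η * ∑ j, ∑ k ∈ Finset.univ.filter (fun k => j < k), ∫ t, contactAt ψ j k t) := by
  have hc := hψ.continuous
  have hρi := fun j => integrable_densityAt hc hs j
  have hκi := fun j : Fin N =>
    integrable_densityAt (continuous_partialDeriv hψ j) (hs.partialDeriv j) j
  have hδi : ∀ j, ∀ k ∈ Finset.univ.filter (fun k => j < k), Integrable (contactAt ψ j k) :=
    fun j k hk => integrable_contactAt hc hs (Finset.mem_filter.1 hk).2.ne'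
  have hδi' := fun j => integrable_finsetSum _ (hδi j)
  have hκ : Integrable fun t => ∑ j, densityAt (partialDeriv ψ j) j t :=
    integrable_finsetSum _ fun j _ => hκi j
  have hδ : Integrable fun t => ∑ j, ∑ k ∈ Finset.univ.filter (fun k => j < k),
      contactAt ψ j k t := integrable_finsetSum _ fun j _ => hδi' j
  have hρ0 : ∀ t, 0 ≤ ∑ j, densityAt ψ j t :=
    fun t => Finset.sum_nonneg fun j _ => densityAt_nonneg ψ j t
  have hκ0 : ∀ t, 0 ≤ ∑ j, densityAt (partialDeriv ψ j) j t :=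
    fun t => Finset.sum_nonneg fun j _ => densityAt_nonneg _ j t
  have hδ0 : ∀ t, 0 ≤ ∑ j, ∑ k ∈ Finset.univ.filter (fun k => j < k), contactAt ψ j k t :=
    fun t => Finset.sum_nonneg fun j _ => Finset.sum_nonneg fun k _ => contactAt_nonneg ψ j k t
  have hρI : ∀ a c, ∫ t in a..c, ∑ j, densityAt ψ j t = ∑ j, ∫ t in a..c, densityAt ψ j t :=
    fun a c => intervalIntegral.integral_finsetSum fun j _ => (hρi j).intervalIntegrable
  have hκI : ∀ a c, ∫ t in a..c, ∑ j, densityAt (partialDeriv ψ j) j t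
      = ∑ j, ∫ t in a..c, densityAt (partialDeriv ψ j) j t :=
    fun a c => intervalIntegral.integral_finsetSum fun j _ => (hκi j).intervalIntegrable
  have hδI : ∀ a c, ∫ t in a..c, ∑ j, ∑ k ∈ Finset.univ.filter (fun k => j < k), contactAt ψ j k t
      = ∑ j, ∑ k ∈ Finset.univ.filter (fun k => j < k), ∫ t in a..c, contactAt ψ j k t := by
    intro a c
    rw [intervalIntegral.integral_finsetSum fun j _ => (hδi' j).intervalIntegrable]
    exact Finset.sum_congr rfl fun j _ =>
      intervalIntegral.integral_finsetSum fun k hk => (hδi j k hk).intervalIntegrable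
  obtain ⟨R, hR0, hR⟩ := exists_sum_densityAt_eq_zero hs
  have hRR : -R ≤ R := by linarith
  have hmass : ∫ t in (-R)..R, ∑ j, densityAt ψ j t ≤ 2 * N := by
    refine (intervalIntegral_le_integral (integrable_finsetSum _ fun j _ => hρi j) hρ0 hRR).trans ?_
    rw [integral_finsetSum _ fun j _ => hρi j]
    simp_rw [integral_densityAt hc hs, hnorm]
    simp [two_mul]
  have hmain := integral_cube_le_of_local_exclusion hη hb hs0 hs1 hsb
    (continuous_sum_densityAt hc hs) hρ0 hκ hκ0 hδ hδ0
    (fun a c x hx y hy α hα => by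
      rw [hρI, hκI, Finset.mul_sum, Finset.mul_sum, ← Finset.sum_add_distrib,
        ← Finset.sum_add_distrib]
      exact Finset.sum_le_sum fun j _ => densityAt_le_add hψ hs j hx hy hα)
    (fun a c hac => by
      rw [hρI, hκI, hδI]
      exact sum_densityAt_sub_one_le hψ hs hnorm hac)
    havg (hR R (le_abs_self R)) N (-R) hRR hmass
  have hcube : ∫ t in (-R)..R, (∑ j, densityAt ψ j t) ^ 3 = ∫ t, (∑ j, densityAt ψ j t) ^ 3 := by
    refine intervalIntegral.integral_eq_integral_of_support_subset fun t ht => ?_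
    have h : |t| < R := by
      by_contra! h
      exact ht (by simp [hR t h])
    exact ⟨(abs_lt.1 h).1, (abs_lt.1 h).2.le⟩
  rw [hcube] at hmain
  have hκle := intervalIntegral_le_integral hκ hκ0 hRR
  have hδle := intervalIntegral_le_integral hδ hδ0 hRR
  rw [integral_finsetSum _ fun j _ => hκi j] at hκle
  rw [integral_finsetSum _ fun j _ => hδi' j,
    Finset.sum_congr rfl fun j _ => integral_finsetSum _ (hδi j)] at hδle
  refine hmain.trans ?_
  gcongr

end Kinetic

section Potential

variable {N : ℕ} {ψ : (Fin N → ℝ) → ℂ}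

lemma integrable_mul_densityAt (hc : Continuous ψ) (hs : HasCompactSupport ψ) (j : Fin N)
    {W : ℝ → ℝ} (hW : Measurable W) (hW0 : ∀ y, 0 ≤ W y)
    (hWi : Integrable fun y => W y ^ ((3 : ℝ) / 2)) :
    Integrable fun t => W t * densityAt ψ j t := by
  have hd := continuous_densityAt hc hs j
  have hcs : HasCompactSupport (densityAt ψ j) := by
    obtain ⟨R, -, hR⟩ := exists_densityAt_eq_zero hs j
    refine HasCompactSupport.intro (isCompact_Icc (a := -R) (b := R)) fun t ht => hR t ?_
    by_contra! h
    exact ht (Set.mem_Icc.2 (abs_le.1 h.le))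
  obtain ⟨C, hC⟩ := hd.bounded_above_of_compact_support hcs
  refine ((integrable_densityAt hc hs j).add (hWi.mul_const C)).mono'
    (hW.aestronglyMeasurable.mul hd.aestronglyMeasurable) (Filter.Eventually.of_forall fun t => ?_)
  have h0 := densityAt_nonneg ψ j t
  have hCt := (le_abs_self _).trans (hC t)
  rw [Real.norm_of_nonneg (mul_nonneg (hW0 t) h0), Pi.add_apply]
  have hp : 0 ≤ W t ^ ((3 : ℝ) / 2) := Real.rpow_nonneg (hW0 t) _
  rcases le_total (W t) 1 with h1 | h1
  · nlinarith [mul_le_mul_of_nonneg_right h1 h0, mul_nonneg hp (h0.trans hCt)]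
  · have h2 : W t ≤ W t ^ ((3 : ℝ) / 2) := by
      conv_lhs => rw [← Real.rpow_one (W t)]
      exact Real.rpow_le_rpow_of_exponent_le h1 (by norm_num)
    nlinarith [mul_le_mul h2 hCt h0 hp]

lemma integrable_mul_norm_sq (hc : Continuous ψ) (hs : HasCompactSupport ψ) (j : Fin N)
    {W : ℝ → ℝ} (hW : Measurable W) (hW0 : ∀ y, 0 ≤ W y)
    (hWi : Integrable fun y => W y ^ ((3 : ℝ) / 2)) :
    Integrable fun x : Fin N → ℝ => W (x j) * ‖ψ x‖ ^ 2 := by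
  rw [← integrable_insertCoord_iff j]
  simp_rw [insertCoord_self]
  rw [integrable_prod_iff]
  · refine ⟨Filter.Eventually.of_forall fun t =>
      (integrable_norm_sq_insertCoord hc hs j t).const_mul (W t), ?_⟩
    refine (integrable_mul_densityAt hc hs j hW hW0 hWi).congr
      (Filter.Eventually.of_forall fun t => ?_)
    simp only [norm_mul, norm_pow, norm_norm, Real.norm_of_nonneg (hW0 t), integral_const_mul]
    rfl
  · exact (hW.comp measurable_fst).aestronglyMeasurable.mul
      ((continuous_comp_insertCoord hc j).norm.pow 2).aestronglyMeasurable

/-- Weighted Young inequality with exponents `3` and `3 / 2`. -/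
lemma mul_le_cube_add_rpow {q r w : ℝ} (hq : 0 < q) (hr : 0 ≤ r) (hw : 0 ≤ w) :
    w * r ≤ q ^ 2 / 3 * r ^ 3 + 2 / 3 * q⁻¹ * w ^ ((3 : ℝ) / 2) := by
  have hp : w ^ ((3 : ℝ) / 2) = √w ^ 3 := by
    rw [Real.sqrt_eq_rpow, ← Real.rpow_natCast, ← Real.rpow_mul hw]
    norm_num
  have hw2 := Real.sq_sqrt hw
  rw [hp]
  set u := √w
  have hu : 0 ≤ u := Real.sqrt_nonneg w
  have key : 0 ≤ (q * r) ^ 3 + 2 * u ^ 3 - 3 * (q * r) * u ^ 2 := by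
    have : (q * r) ^ 3 + 2 * u ^ 3 - 3 * (q * r) * u ^ 2
        = (q * r - u) ^ 2 * (q * r + 2 * u) := by ring
    rw [this]
    positivity
  have hdiff : q ^ 2 / 3 * r ^ 3 + 2 / 3 * q⁻¹ * u ^ 3 - w * r
      = q⁻¹ / 3 * ((q * r) ^ 3 + 2 * u ^ 3 - 3 * (q * r) * u ^ 2) := by
    rw [← hw2]
    field_simp
  have : 0 ≤ q⁻¹ / 3 * ((q * r) ^ 3 + 2 * u ^ 3 - 3 * (q * r) * u ^ 2) := by positivity
  linarith

/-- The negative part of the potential energy is bounded by `∫ ρ³` and `∫ W ^ (3 / 2)`. -/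
lemma integral_sum_mul_norm_sq_le (hc : Continuous ψ) (hs : HasCompactSupport ψ)
    {W : ℝ → ℝ} (hW : Measurable W) (hW0 : ∀ y, 0 ≤ W y)
    (hWi : Integrable fun y => W y ^ ((3 : ℝ) / 2)) {q : ℝ} (hq : 0 < q) :
    ∫ x : Fin N → ℝ, ∑ j, W (x j) * ‖ψ x‖ ^ 2
      ≤ q ^ 2 / 3 * (∫ t, (∑ j, densityAt ψ j t) ^ 3)
        + 2 / 3 * q⁻¹ * ∫ t, W t ^ ((3 : ℝ) / 2) := by
  have hi := fun j => integrable_mul_norm_sq hc hs j hW hW0 hWi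
  have hd := fun j => integrable_mul_densityAt hc hs j hW hW0 hWi
  have hcube : Integrable fun t => (∑ j, densityAt ψ j t) ^ 3 := by
    refine Continuous.integrable_of_hasCompactSupport
      ((continuous_sum_densityAt hc hs).pow 3) ?_
    exact (hasCompactSupport_sum_densityAt hs).comp_left (g := fun r : ℝ => r ^ 3)
      (zero_pow three_ne_zero)
  calc ∫ x : Fin N → ℝ, ∑ j, W (x j) * ‖ψ x‖ ^ 2
      = ∑ j, ∫ x : Fin N → ℝ, W (x j) * ‖ψ x‖ ^ 2 := integral_finsetSum _ fun j _ => hi j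
    _ = ∑ j, ∫ t, W t * densityAt ψ j t :=
        Finset.sum_congr rfl fun j _ => integral_mul_norm_sq j (hi j)
    _ = ∫ t, ∑ j, W t * densityAt ψ j t := (integral_finsetSum _ fun j _ => hd j).symm
    _ ≤ ∫ t, (q ^ 2 / 3 * (∑ j, densityAt ψ j t) ^ 3
          + 2 / 3 * q⁻¹ * W t ^ ((3 : ℝ) / 2)) := by
        refine integral_mono (integrable_finsetSum _ fun j _ => hd j)
          ((hcube.const_mul _).add (hWi.const_mul _)) fun t => ?_
        beta_reduce
        rw [← Finset.mul_sum]
        exact mul_le_cube_add_rpow hq (Finset.sum_nonneg fun j _ => densityAt_nonneg ψ j t) (hW0 t)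
    _ = _ := by
        rw [integral_add (hcube.const_mul _) (hWi.const_mul _), integral_const_mul,
          integral_const_mul]

lemma neg_integral_abs_min_le (hc : Continuous ψ) (hs : HasCompactSupport ψ)
    {V : ℝ → ℝ} (hV : Measurable V)
    (hVm : Integrable (fun y => |min (V y) 0| ^ ((3 : ℝ) / 2))) :
    -∫ x : Fin N → ℝ, ∑ j, |min (V (x j)) 0| * ‖ψ x‖ ^ 2
      ≤ ∫ x : Fin N → ℝ, (∑ j, V (x j)) * ‖ψ x‖ ^ 2 := by
  by_cases hi : Integrable fun x : Fin N → ℝ => (∑ j, V (x j)) * ‖ψ x‖ ^ 2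
  · rw [← integral_neg]
    refine integral_mono (integrable_finsetSum _ fun j _ => integrable_mul_norm_sq hc hs j
      (hV.min measurable_const).abs (fun y => abs_nonneg _) hVm).neg hi fun x => ?_
    beta_reduce
    rw [Finset.sum_mul, ← Finset.sum_neg_distrib]
    refine Finset.sum_le_sum fun j _ => ?_
    rw [← neg_mul]
    refine mul_le_mul_of_nonneg_right ?_ (by positivity)
    rw [abs_of_nonpos (min_le_right _ _), neg_neg]
    exact min_le_left _ _
  · rw [integral_undef hi, neg_nonpos]
    exact integral_nonneg fun x => Finset.sum_nonneg fun j _ => by positivity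

end Potential

/-- **Lieb–Thirring inequality for the 1D Lieb–Liniger model.** For `η > 0`, a normalized
symmetric `ψ ∈ C_c^∞(ℝᴺ)` whose one-particle density `ρ` has all interval averages
bounded by `b`, and a potential `V` with `∫|V₋|^{3/2} < ∞`,
`T_S(ψ) + ∫ ∑_j V(x_j)|ψ|² ≥ -((2/3)(9·10⁻⁵)^{-1/2}/ξ_S(2η/b)) ∫ |V₋|^{3/2}`. -/
theorem lieb_thirring_inequality_lieb_liniger
    (η : ℝ) (hη : 0 < η) (N : ℕ) (hN : 1 ≤ N) (b : ℝ) (hb : 0 < b)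
    (ξS : ℝ → ℝ)
    (hξS : ∀ y : ℝ, 0 ≤ y →
      0 ≤ ξS y ∧ ξS y < Real.pi / 2 ∧ ξS y * Real.tan (ξS y) = y)
    (ψ : (Fin N → ℝ) → ℂ)
    (hψ : ContDiff ℝ (⊤ : ℕ∞) ψ) (hcs : HasCompactSupport ψ)
    (hsym : ∀ (σ : Equiv.Perm (Fin N)) (x : Fin N → ℝ), ψ (x ∘ σ) = ψ x)
    (hnorm : ∫ x : Fin N → ℝ, ‖ψ x‖ ^ 2 = 1)
    (havg : ∀ a c : ℝ, a < c →
      (∫ y in Set.Icc a c, (N : ℝ) * densityAt ψ (⟨0, by omega⟩ : Fin N) y) / (c - a) ≤ b)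
    (V : ℝ → ℝ) (hV : Measurable V)
    (hVm : Integrable (fun y => |min (V y) 0| ^ ((3 : ℝ) / 2))) :
    ((1 / 2) * (∫ x : Fin N → ℝ, ∑ j : Fin N, ‖fderiv ℝ ψ x (Pi.single j 1)‖ ^ 2)
        + 2 * η * ∑ j : Fin N, ∑ k ∈ Finset.univ.filter (fun k => j < k),
            ∫ t : ℝ, ∫ z : {l : Fin N // l ≠ j ∧ l ≠ k} → ℝ,
              ‖ψ (insertPair j k t z)‖ ^ 2)
      + (∫ x : Fin N → ℝ, (∑ j : Fin N, V (x j)) * ‖ψ x‖ ^ 2)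
      ≥ -((2 / 3) * (Real.sqrt 9e-5)⁻¹ / ξS (2 * η / b)) *
          ∫ y : ℝ, |min (V y) 0| ^ ((3 : ℝ) / 2) := by
  have hc := hψ.continuous
  obtain ⟨hξ0, hξ1, hξt⟩ := hξS (2 * η / b) (by positivity)
  set ξ := ξS (2 * η / b)
  have hξ : 0 < ξ := by
    refine hξ0.lt_of_ne fun h => ?_
    rw [← h, zero_mul] at hξt
    exact (by positivity : 0 < 2 * η / b).ne hξt
  have hξsq : ξ ^ 2 ≤ 5 / 2 := by nlinarith [Real.pi_lt_d2]
  have hξb : ξ ^ 2 ≤ 2 * η / b := by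
    rw [← hξt, sq]
    exact mul_le_mul_of_nonneg_left (Real.le_tan hξ0 hξ1) hξ0
  have hρ : ∀ t, ∑ j, densityAt ψ j t = N * densityAt ψ (⟨0, by omega⟩ : Fin N) t := fun t => by
    simp [densityAt_eq_of_symmetric hsym _ (⟨0, by omega⟩ : Fin N)]
  have hkin := mul_integral_density_cube_le hψ hcs hnorm hη hb (sq_nonneg ξ) hξsq hξb
    fun a c hac => by
      rcases hac.eq_or_lt with rfl | hac'
      · simp
      · have h := havg a c hac'
        rw [div_le_iff₀ (sub_pos.2 hac'), integral_Icc_eq_integral_Ioc,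
          ← intervalIntegral.integral_of_le hac] at h
        simpa only [hρ] using h
  have hgrad : ∫ x : Fin N → ℝ, ∑ j : Fin N, ‖fderiv ℝ ψ x (Pi.single j 1)‖ ^ 2
      = ∑ j, ∫ t, densityAt (partialDeriv ψ j) j t := by
    refine (integral_finsetSum _ fun j _ => (hcs.partialDeriv j).integrable_norm_sq
      (continuous_partialDeriv hψ j)).trans ?_
    exact Finset.sum_congr rfl fun j _ =>
      (integral_densityAt (continuous_partialDeriv hψ j) (hcs.partialDeriv j) j).symm
  have hq : 0 < Real.sqrt 9e-5 * ξ := by positivity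
  have hpot := integral_sum_mul_norm_sq_le hc hcs (W := fun y => |min (V y) 0|)
    (hV.min measurable_const).abs (fun y => abs_nonneg _) hVm hq
  have hneg := neg_integral_abs_min_le hc hcs hV hVm
  have hq2 : (Real.sqrt 9e-5 * ξ) ^ 2 / 3 = 3 / 100000 * ξ ^ 2 := by
    rw [mul_pow, Real.sq_sqrt (by norm_num)]
    ring
  rw [hq2, mul_inv] at hpot
  have hcube0 : 0 ≤ ξ ^ 2 * ∫ t, (∑ j, densityAt ψ j t) ^ 3 :=
    mul_nonneg (sq_nonneg ξ) (integral_nonneg fun t =>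
      pow_nonneg (Finset.sum_nonneg fun j _ => densityAt_nonneg ψ j t) 3)
  have hconst : 2 / 3 * (Real.sqrt 9e-5)⁻¹ / ξ = 2 / 3 * ((Real.sqrt 9e-5)⁻¹ * ξ⁻¹) := by
    rw [div_eq_mul_inv, mul_assoc]
  rw [hgrad, hconst]
  simp only [contactAt] at hkin
  linarith
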